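/- Suppose α is an isophote with axis d and angle θ with sin θ ≠ 0, κ(s) > 0 for all s, and k_n(s) ≠ 0 for all s. Then ⟪n(s), d⟫ = 0 for all s (the axis d is perpendicular to the principal normal line of α) if and only if the function s ↦ τ_g(s)/k_n(s) is constant. -/

import Mathlib

open scoped RealInnerProductSpace

noncomputable section

/-- The cross product on `EuclideanSpace ℝ (Fin 3)`. -/
def cross3 (u v : EuclideanSpace ℝ (Fin 3)) : EuclideanSpace ℝ (Fin 3) :=
  (EuclideanSpace.equiv (Fin 3) ℝ).symm
    (crossProduct ((EuclideanSpace.equiv (Fin 3) ℝ) u) ((EuclideanSpace.equiv (Fin 3) ℝ) v))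

theorem cross3_gram (u v x y : EuclideanSpace ℝ (Fin 3)) :
    ⟪cross3 u v, x⟫ * ⟪cross3 u v, y⟫ =
      ⟪u, u⟫ * (⟪v, v⟫ * ⟪x, y⟫ - ⟪v, x⟫ * ⟪v, y⟫)
        - ⟪u, v⟫ * (⟪u, v⟫ * ⟪x, y⟫ - ⟪v, y⟫ * ⟪u, x⟫)
        + ⟪u, y⟫ * (⟪u, v⟫ * ⟪v, x⟫ - ⟪v, v⟫ * ⟪u, x⟫) := by
  simp only [PiLp.inner_apply, Fin.sum_univ_three]
  simp [cross3, cross_apply]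
  ring

theorem inner_eq_sum_orthonormal_frame {u v : EuclideanSpace ℝ (Fin 3)}
    (hu : ‖u‖ = 1) (hv : ‖v‖ = 1) (huv : ⟪u, v⟫ = 0) (x y : EuclideanSpace ℝ (Fin 3)) :
    ⟪x, y⟫ = ⟪u, x⟫ * ⟪u, y⟫ + ⟪v, x⟫ * ⟪v, y⟫ + ⟪cross3 u v, x⟫ * ⟪cross3 u v, y⟫ := by
  rw [cross3_gram, huv, real_inner_self_eq_norm_sq, real_inner_self_eq_norm_sq, hu, hv]
  ring

theorem inner_self_cross3 (u v : EuclideanSpace ℝ (Fin 3)) : ⟪u, cross3 u v⟫ = 0 := by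
  simp [cross3, PiLp.inner_apply, Fin.sum_univ_three, cross_apply]
  ring

theorem Differentiable.cross3 {f g : ℝ → EuclideanSpace ℝ (Fin 3)}
    (hf : Differentiable ℝ f) (hg : Differentiable ℝ g) :
    Differentiable ℝ (fun s => _root_.cross3 (f s) (g s)) := by
  rw [differentiable_euclidean] at hf hg ⊢
  intro i
  have hf0 := hf 0
  have hf1 := hf 1
  have hf2 := hf 2
  have hg0 := hg 0
  have hg1 := hg 1
  have hg2 := hg 2
  fin_cases i <;> simp [_root_.cross3, cross_apply] <;> fun_prop

theorem inner_deriv_add_inner_deriv_eq_zero {E : Type*} [NormedAddCommGroup E]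
    [InnerProductSpace ℝ E] {f g : ℝ → E} (hf : Differentiable ℝ f) (hg : Differentiable ℝ g)
    {c : ℝ} (h : ∀ s, ⟪f s, g s⟫ = c) (s : ℝ) :
    ⟪deriv f s, g s⟫ + ⟪deriv g s, f s⟫ = 0 := by
  have h1 := (hf s).hasDerivAt.inner ℝ (hg s).hasDerivAt
  have h2 : (fun t => ⟪f t, g t⟫) = fun _ => c := funext h
  rw [h2] at h1
  have h3 := h1.unique (hasDerivAt_const s c)
  rw [real_inner_comm (f s) (deriv g s)]
  linarith

/-- A differentiable function whose square is constant is constant. -/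
theorem deriv_eq_zero_of_sq_const {f : ℝ → ℝ} (hf : Differentiable ℝ f) {c : ℝ}
    (h : ∀ s, f s ^ 2 = c) (s : ℝ) : deriv f s = 0 := by
  rcases eq_or_ne (f s) 0 with h0 | h0
  · have hz : f = fun _ => 0 := by
      funext t
      rw [← sq_eq_zero_iff, h t, ← h s, h0]
      norm_num
    simp [hz]
  · have h1 := (hf s).hasDerivAt.pow 2
    have h2 : f ^ 2 = fun _ => c := funext h
    rw [h2] at h1
    have h3 := h1.unique (hasDerivAt_const s c)
    simpa [h0] using h3

theorem stmt8
    (α N : ℝ → EuclideanSpace ℝ (Fin 3))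
    (hα : ContDiff ℝ (⊤ : ℕ∞) α) (hN : ContDiff ℝ (⊤ : ℕ∞) N)
    (hunit : ∀ s, ‖deriv α s‖ = 1)
    (hNunit : ∀ s, ‖N s‖ = 1)
    (hNT : ∀ s, ⟪N s, deriv α s⟫ = 0)
    (T B : ℝ → EuclideanSpace ℝ (Fin 3))
    (hT : ∀ s, T s = deriv α s)
    (hB : ∀ s, B s = cross3 (N s) (T s))
    (kn kg τg : ℝ → ℝ)
    (hkn : ∀ s, kn s = ⟪deriv T s, N s⟫)
    (hkg : ∀ s, kg s = ⟪deriv T s, B s⟫)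
    (hτg : ∀ s, τg s = ⟪deriv B s, N s⟫)
    (κ τ : ℝ → ℝ) (n b : ℝ → EuclideanSpace ℝ (Fin 3))
    (hκ : ∀ s, κ s = ‖deriv (deriv α) s‖)
    (hκpos : ∀ s, 0 < κ s)
    (hn : ∀ s, n s = (κ s)⁻¹ • deriv (deriv α) s)
    (hb : ∀ s, b s = cross3 (deriv α s) (n s))
    (hτ : ∀ s, τ s = ⟪cross3 (deriv α s) (deriv (deriv α) s), deriv (deriv (deriv α)) s⟫ / κ s ^ 2)
    (d : EuclideanSpace ℝ (Fin 3)) (hd : ‖d‖ = 1) (θ : ℝ)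
    (hiso : ∀ s, ⟪N s, d⟫ = Real.cos θ)
    (hsin : Real.sin θ ≠ 0)
    (hknne : ∀ s, kn s ≠ 0) :
    (∀ s, ⟪n s, d⟫ = 0) ↔ (∀ s t, τg s / kn s = τg t / kn t) := by
  obtain rfl : T = deriv α := funext hT
  have dN : Differentiable ℝ N := hN.differentiable (by simp)
  have dT : Differentiable ℝ (deriv α) := by
    have h : ContDiff ℝ 2 α := contDiff_infty.1 hα 2
    exact ((contDiff_succ_iff_deriv (n := 1)).1 h).2.2.differentiable (by simp)
  have dB : Differentiable ℝ B := by
    rw [show B = _ from funext hB]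
    exact dN.cross3 dT
  have hrel : ∀ s, kn s * ⟪deriv α s, d⟫ + τg s * ⟪B s, d⟫ = 0 := by
    intro s
    have eN := inner_deriv_add_inner_deriv_eq_zero dN dN
      (c := 1) (fun s => by rw [real_inner_self_eq_norm_sq, hNunit]; norm_num) s
    have eT := inner_deriv_add_inner_deriv_eq_zero dN dT hNT s
    have eB := inner_deriv_add_inner_deriv_eq_zero dN dB
      (fun s => by rw [hB]; exact inner_self_cross3 _ _) s
    have ed := inner_deriv_add_inner_deriv_eq_zero dN (differentiable_const d) hiso s
    have hp := inner_eq_sum_orthonormal_frame (hNunit s) (hunit s) (hNT s) (deriv N s) d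
    rw [← hB s, real_inner_comm (deriv N s) (N s), real_inner_comm (deriv N s) (deriv α s),
      real_inner_comm (deriv N s) (B s)] at hp
    simp only [deriv_const, inner_zero_left, add_zero] at ed
    rw [← hkn] at eT
    rw [← hτg] at eB
    linear_combination ⟪deriv α s, d⟫ * eT + ⟪B s, d⟫ * eB + ⟪N s, d⟫ * eN / 2 + hp - ed
  have hsum : ∀ s, ⟪deriv α s, d⟫ ^ 2 + ⟪B s, d⟫ ^ 2 = Real.sin θ ^ 2 := by
    intro s
    have hp := inner_eq_sum_orthonormal_frame (hNunit s) (hunit s) (hNT s) d d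
    rw [← hB s, hiso, real_inner_self_eq_norm_sq, hd] at hp
    linear_combination -hp - Real.sin_sq_add_cos_sq θ
  have hratio : ∀ s, ⟪deriv α s, d⟫ = -(τg s / kn s) * ⟪B s, d⟫ := by
    intro s
    have := hknne s
    field_simp
    linear_combination hrel s
  have hBd : ∀ s, ⟪B s, d⟫ ≠ 0 := by
    intro s h0
    have h := hsum s
    rw [hratio s, h0] at h
    exact hsin (by simpa using h.symm)
  have da : Differentiable ℝ (fun s => ⟪deriv α s, d⟫) := dT.inner ℝ (differentiable_const d)
  have dc : Differentiable ℝ (fun s => ⟪B s, d⟫) := dB.inner ℝ (differentiable_const d)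
  have hder : ∀ s, deriv (fun s => ⟪deriv α s, d⟫) s = κ s * ⟪n s, d⟫ := by
    intro s
    have h := ((dT s).hasDerivAt.inner ℝ (hasDerivAt_const s d)).deriv
    rw [h, hn, real_inner_smul_left, mul_inv_cancel_left₀ (hκpos s).ne']
    simp
  constructor
  · intro h s t
    have ha := is_const_of_deriv_eq_zero da (fun s => by rw [hder, h, mul_zero])
    have hc := is_const_of_deriv_eq_zero dc
      (deriv_eq_zero_of_sq_const dc (c := Real.sin θ ^ 2 - ⟪deriv α 0, d⟫ ^ 2) (fun s => by
        have has := ha s 0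
        rw [← hsum s, has]
        ring))
    have hast := ha s t
    have hcst := hc s t
    rw [hratio s, hratio t, hcst] at hast
    simpa using mul_right_cancel₀ (hBd t) hast
  · intro h s
    have hsq : ∀ s, ⟪deriv α s, d⟫ ^ 2 =
        (τg 0 / kn 0) ^ 2 * Real.sin θ ^ 2 / (1 + (τg 0 / kn 0) ^ 2) := by
      intro s
      have hr := hratio s
      rw [h s 0] at hr
      have hpos : 1 + (τg 0 / kn 0) ^ 2 ≠ 0 := by positivity
      rw [eq_div_iff hpos, ← hsum s, hr]
      ring
    have h0 := deriv_eq_zero_of_sq_const da hsq s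
    rw [hder] at h0
    exact (mul_eq_zero.1 h0).resolve_left (hκpos s).ne'
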